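/- arXiv:2503.01153 — 4 statements merged into one kernel-verified Lean document; each statement's English description precedes it below -/
import Mathlib

section
/- Let G = {w ∈ Ŵ : w({α0+α1, α2+α3}) = {α0+α1, α2+α3}} be the setwise stabilizer of the two-element set {α0+α1, α2+α3} in Ŵ. Then G equals the subgroup of Ŵ generated by the six elements r_{β0} = w0∘w3∘w0, r_{β1} = w1∘w2∘w1, π_β = (σ1∘σ2)², r_{γ0} = σ2∘w2∘w0, r_{γ1} = σ1∘σ2∘σ1∘w3∘w1, and π_γ = σ1. -/
open Pointwise

/-- The Picard lattice `Pic`, with basis `H1, H2, E1, …, E8`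
(coordinates `0 ↦ H1`, `1 ↦ H2`, `i+1 ↦ Eᵢ`). -/
abbrev Pic : Type := Fin 10 → ℤ

/-- The intersection form `•` : `H1•H2 = 1`, `Eᵢ•Eᵢ = -1`, all other pairings
of basis vectors being `0`. -/
def inter (x y : Pic) : ℤ :=
  x 0 * y 1 + x 1 * y 0 -
    (x 2 * y 2 + x 3 * y 3 + x 4 * y 4 + x 5 * y 5 + x 6 * y 6 +
      x 7 * y 7 + x 8 * y 8 + x 9 * y 9)

/-- The `j`-th basis vector of `Pic`. -/
def bvec (j : Fin 10) : Pic := fun k => if k = j then 1 else 0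

/-- The matrix of the reflection `C ↦ C + (C • a)·a` in `a`. -/
def reflMat (a : Pic) : Matrix (Fin 10) (Fin 10) ℤ :=
  Matrix.of fun k j => (if k = j then 1 else 0) + inter (bvec j) a * a k

/-- The matrix of the linear map sending the basis vector `e j` to `e (p j)`. -/
def permMat (p : Fin 10 → Fin 10) : Matrix (Fin 10) (Fin 10) ℤ :=
  Matrix.of fun k j => if p j = k then 1 else 0

/-- `α₀ = H2 - E1 - E2`. -/
def al0 : Pic := ![0, 1, -1, -1, 0, 0, 0, 0, 0, 0]
/-- `α₁ = H1 - E5 - E6`. -/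
def al1 : Pic := ![1, 0, 0, 0, 0, 0, -1, -1, 0, 0]
/-- `α₂ = H2 - E3 - E4`. -/
def al2 : Pic := ![0, 1, 0, 0, -1, -1, 0, 0, 0, 0]
/-- `α₃ = H1 - E7 - E8`. -/
def al3 : Pic := ![1, 0, 0, 0, 0, 0, 0, 0, -1, -1]
/-- `δ = 2H1 + 2H2 - E1 - ⋯ - E8`. -/
def dl : Pic := ![2, 2, -1, -1, -1, -1, -1, -1, -1, -1]
/-- `μ = H1 - H2`. -/
def mu : Pic := ![1, -1, 0, 0, 0, 0, 0, 0, 0, 0]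

/-- Automorphisms of the lattice `Pic`, realized as invertible integer `10 × 10`
matrices (acting on coordinate vectors by matrix-vector multiplication). -/
abbrev PicAut : Type := (Matrix (Fin 10) (Fin 10) ℤ)ˣ

/-- Build an automorphism of `Pic` out of an involutive matrix. -/
def mkAut (M : Matrix (Fin 10) (Fin 10) ℤ) (h : M * M = 1) : PicAut := ⟨M, M, h, h⟩

/-- `w₀`, the reflection `C ↦ C + (C•α₀)α₀`. -/
def w0 : PicAut := mkAut (reflMat al0) (by decide)
/-- `w₁`, the reflection `C ↦ C + (C•α₁)α₁`. -/
def w1 : PicAut := mkAut (reflMat al1) (by decide)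
/-- `w₂`, the reflection `C ↦ C + (C•α₂)α₂`. -/
def w2 : PicAut := mkAut (reflMat al2) (by decide)
/-- `w₃`, the reflection `C ↦ C + (C•α₃)α₃`. -/
def w3 : PicAut := mkAut (reflMat al3) (by decide)
/-- `σ₁`: the basis permutation `E1↔E7, E2↔E8, E3↔E5, E4↔E6` (fixing `H1`, `H2`)
composed with the reflection `w_μ` in `μ = H1 - H2`. -/
def sg1 : PicAut := mkAut (permMat ![0, 1, 8, 9, 6, 7, 4, 5, 2, 3] * reflMat mu) (by decide)
/-- `σ₂`: the basis permutation `E1↔E3, E2↔E4` (fixing the other basis vectors). -/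
def sg2 : PicAut := mkAut (permMat ![0, 1, 4, 5, 2, 3, 6, 7, 8, 9]) (by decide)
/-- `σ₃`: the basis permutation `E5↔E7, E6↔E8` (fixing the other basis vectors). -/
def sg3 : PicAut := mkAut (permMat ![0, 1, 2, 3, 4, 5, 8, 9, 6, 7]) (by decide)

/-- The action of an automorphism on `Pic`. -/
def act (g : PicAut) (v : Pic) : Pic := g.val.mulVec v

instance : MulAction PicAut Pic where
  smul := act
  one_smul v := by
    show act 1 v = v
    simp [act]
  mul_smul g h v := by
    show act (g * h) v = act g (act h v)
    simp [act, Matrix.mulVec_mulVec]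

lemma smul_eq_act (g : PicAut) (v : Pic) : g • v = act g v := rfl

/-- The fully extended affine Weyl group `Ŵ` of type `A₃⁽¹⁾`, i.e. the subgroup
of automorphisms of `Pic` generated by `w₀, w₁, w₂, w₃, σ₁, σ₂`. -/
def Wh : Subgroup PicAut := Subgroup.closure {w0, w1, w2, w3, sg1, sg2}

/-- The two-element set `{α₀+α₁, α₂+α₃} ⊆ Pic`. -/
def Spair : Set Pic := {al0 + al1, al2 + al3}

/-! ### Relations between the generators, oriented as rewriting rules -/

@[simp] lemma w0_mul_self : w0 * w0 = 1 := by
  apply Units.ext; decide +kernel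

@[simp] lemma w1_mul_self : w1 * w1 = 1 := by
  apply Units.ext; decide +kernel

@[simp] lemma w2_mul_self : w2 * w2 = 1 := by
  apply Units.ext; decide +kernel

@[simp] lemma w3_mul_self : w3 * w3 = 1 := by
  apply Units.ext; decide +kernel

@[simp] lemma sg1_mul_self : sg1 * sg1 = 1 := by
  apply Units.ext; decide +kernel

@[simp] lemma sg2_mul_self : sg2 * sg2 = 1 := by
  apply Units.ext; decide +kernel

@[simp] lemma sg1_mul_w0 : sg1 * w0 = w3 * sg1 := by
  apply Units.ext; decide +kernel

@[simp] lemma sg1_mul_w1 : sg1 * w1 = w2 * sg1 := by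
  apply Units.ext; decide +kernel

@[simp] lemma sg1_mul_w2 : sg1 * w2 = w1 * sg1 := by
  apply Units.ext; decide +kernel

@[simp] lemma sg1_mul_w3 : sg1 * w3 = w0 * sg1 := by
  apply Units.ext; decide +kernel

@[simp] lemma sg2_mul_w0 : sg2 * w0 = w2 * sg2 := by
  apply Units.ext; decide +kernel

@[simp] lemma sg2_mul_w1 : sg2 * w1 = w1 * sg2 := by
  apply Units.ext; decide +kernel

@[simp] lemma sg2_mul_w2 : sg2 * w2 = w0 * sg2 := by
  apply Units.ext; decide +kernel

@[simp] lemma sg2_mul_w3 : sg2 * w3 = w3 * sg2 := by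
  apply Units.ext; decide +kernel

@[simp] lemma w2_mul_w0 : w2 * w0 = w0 * w2 := by
  apply Units.ext; decide +kernel

@[simp] lemma w3_mul_w1 : w3 * w1 = w1 * w3 := by
  apply Units.ext; decide +kernel

@[simp] lemma w1_w0_braid : w1 * (w0 * w1) = w0 * (w1 * w0) := by
  apply Units.ext; decide +kernel

@[simp] lemma w2_w1_braid : w2 * (w1 * w2) = w1 * (w2 * w1) := by
  apply Units.ext; decide +kernel

@[simp] lemma w3_w2_braid : w3 * (w2 * w3) = w2 * (w3 * w2) := by
  apply Units.ext; decide +kernel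

@[simp] lemma w3_w0_braid : w3 * (w0 * w3) = w0 * (w3 * w0) := by
  apply Units.ext; decide +kernel

@[simp] lemma sg2_sg1_braid : sg2 * (sg1 * (sg2 * sg1)) = sg1 * (sg2 * (sg1 * sg2)) := by
  apply Units.ext; decide +kernel

@[simp] lemma w0_mul_self_assoc (x : PicAut) :
    w0 * (w0 * x) = x := by
  simpa only [mul_assoc, one_mul] using congrArg (· * x) w0_mul_self

@[simp] lemma w1_mul_self_assoc (x : PicAut) :
    w1 * (w1 * x) = x := by
  simpa only [mul_assoc, one_mul] using congrArg (· * x) w1_mul_self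

@[simp] lemma w2_mul_self_assoc (x : PicAut) :
    w2 * (w2 * x) = x := by
  simpa only [mul_assoc, one_mul] using congrArg (· * x) w2_mul_self

@[simp] lemma w3_mul_self_assoc (x : PicAut) :
    w3 * (w3 * x) = x := by
  simpa only [mul_assoc, one_mul] using congrArg (· * x) w3_mul_self

@[simp] lemma sg1_mul_self_assoc (x : PicAut) :
    sg1 * (sg1 * x) = x := by
  simpa only [mul_assoc, one_mul] using congrArg (· * x) sg1_mul_self

@[simp] lemma sg2_mul_self_assoc (x : PicAut) :
    sg2 * (sg2 * x) = x := by
  simpa only [mul_assoc, one_mul] using congrArg (· * x) sg2_mul_self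

@[simp] lemma sg1_mul_w0_assoc (x : PicAut) :
    sg1 * (w0 * x) = w3 * (sg1 * x) := by
  simpa only [mul_assoc, one_mul] using congrArg (· * x) sg1_mul_w0

@[simp] lemma sg1_mul_w1_assoc (x : PicAut) :
    sg1 * (w1 * x) = w2 * (sg1 * x) := by
  simpa only [mul_assoc, one_mul] using congrArg (· * x) sg1_mul_w1

@[simp] lemma sg1_mul_w2_assoc (x : PicAut) :
    sg1 * (w2 * x) = w1 * (sg1 * x) := by
  simpa only [mul_assoc, one_mul] using congrArg (· * x) sg1_mul_w2

@[simp] lemma sg1_mul_w3_assoc (x : PicAut) :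
    sg1 * (w3 * x) = w0 * (sg1 * x) := by
  simpa only [mul_assoc, one_mul] using congrArg (· * x) sg1_mul_w3

@[simp] lemma sg2_mul_w0_assoc (x : PicAut) :
    sg2 * (w0 * x) = w2 * (sg2 * x) := by
  simpa only [mul_assoc, one_mul] using congrArg (· * x) sg2_mul_w0

@[simp] lemma sg2_mul_w1_assoc (x : PicAut) :
    sg2 * (w1 * x) = w1 * (sg2 * x) := by
  simpa only [mul_assoc, one_mul] using congrArg (· * x) sg2_mul_w1

@[simp] lemma sg2_mul_w2_assoc (x : PicAut) :
    sg2 * (w2 * x) = w0 * (sg2 * x) := by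
  simpa only [mul_assoc, one_mul] using congrArg (· * x) sg2_mul_w2

@[simp] lemma sg2_mul_w3_assoc (x : PicAut) :
    sg2 * (w3 * x) = w3 * (sg2 * x) := by
  simpa only [mul_assoc, one_mul] using congrArg (· * x) sg2_mul_w3

@[simp] lemma w2_mul_w0_assoc (x : PicAut) :
    w2 * (w0 * x) = w0 * (w2 * x) := by
  simpa only [mul_assoc, one_mul] using congrArg (· * x) w2_mul_w0

@[simp] lemma w3_mul_w1_assoc (x : PicAut) :
    w3 * (w1 * x) = w1 * (w3 * x) := by
  simpa only [mul_assoc, one_mul] using congrArg (· * x) w3_mul_w1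

@[simp] lemma w1_w0_braid_assoc (x : PicAut) :
    w1 * (w0 * (w1 * x)) = w0 * (w1 * (w0 * x)) := by
  simpa only [mul_assoc, one_mul] using congrArg (· * x) w1_w0_braid

@[simp] lemma w2_w1_braid_assoc (x : PicAut) :
    w2 * (w1 * (w2 * x)) = w1 * (w2 * (w1 * x)) := by
  simpa only [mul_assoc, one_mul] using congrArg (· * x) w2_w1_braid

@[simp] lemma w3_w2_braid_assoc (x : PicAut) :
    w3 * (w2 * (w3 * x)) = w2 * (w3 * (w2 * x)) := by
  simpa only [mul_assoc, one_mul] using congrArg (· * x) w3_w2_braid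

@[simp] lemma w3_w0_braid_assoc (x : PicAut) :
    w3 * (w0 * (w3 * x)) = w0 * (w3 * (w0 * x)) := by
  simpa only [mul_assoc, one_mul] using congrArg (· * x) w3_w0_braid

@[simp] lemma sg2_sg1_braid_assoc (x : PicAut) :
    sg2 * (sg1 * (sg2 * (sg1 * x))) = sg1 * (sg2 * (sg1 * (sg2 * x))) := by
  simpa only [mul_assoc, one_mul] using congrArg (· * x) sg2_sg1_braid

@[simp] lemma w0_inv : w0⁻¹ = w0 := inv_eq_of_mul_eq_one_left w0_mul_self

@[simp] lemma w1_inv : w1⁻¹ = w1 := inv_eq_of_mul_eq_one_left w1_mul_self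

@[simp] lemma w2_inv : w2⁻¹ = w2 := inv_eq_of_mul_eq_one_left w2_mul_self

@[simp] lemma w3_inv : w3⁻¹ = w3 := inv_eq_of_mul_eq_one_left w3_mul_self

@[simp] lemma sg1_inv : sg1⁻¹ = sg1 := inv_eq_of_mul_eq_one_left sg1_mul_self

@[simp] lemma sg2_inv : sg2⁻¹ = sg2 := inv_eq_of_mul_eq_one_left sg2_mul_self

/-! ### The action on the symmetry roots -/

@[simp] lemma act_one (x : Pic) : act 1 x = x := Matrix.one_mulVec x

lemma act_mul (g h : PicAut) (x : Pic) : act (g * h) x = act g (act h x) :=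
  (Matrix.mulVec_mulVec _ _ _).symm

@[simp] lemma act_inv_act (g : PicAut) (x : Pic) : act g⁻¹ (act g x) = x := by
  rw [← act_mul, inv_mul_cancel, act_one]

@[simp] lemma act_add (g : PicAut) (x y : Pic) : act g (x + y) = act g x + act g y :=
  Matrix.mulVec_add _ _ _

@[simp] lemma act_neg (g : PicAut) (x : Pic) : act g (-x) = -act g x :=
  Matrix.mulVec_neg _ _

@[simp] lemma act_zsmul (g : PicAut) (k : ℤ) (x : Pic) : act g (k • x) = k • act g x :=
  Matrix.mulVec_smul _ _ _

@[simp] lemma act_w0_al0 : act w0 al0 = -al0 := by decide +kernel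

@[simp] lemma act_w0_al1 : act w0 al1 = al1 + al0 := by decide +kernel

@[simp] lemma act_w0_al2 : act w0 al2 = al2 := by decide +kernel

@[simp] lemma act_w0_al3 : act w0 al3 = al3 + al0 := by decide +kernel

@[simp] lemma act_w1_al0 : act w1 al0 = al0 + al1 := by decide +kernel

@[simp] lemma act_w1_al1 : act w1 al1 = -al1 := by decide +kernel

@[simp] lemma act_w1_al2 : act w1 al2 = al2 + al1 := by decide +kernel

@[simp] lemma act_w1_al3 : act w1 al3 = al3 := by decide +kernel

@[simp] lemma act_w2_al0 : act w2 al0 = al0 := by decide +kernel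

@[simp] lemma act_w2_al1 : act w2 al1 = al1 + al2 := by decide +kernel

@[simp] lemma act_w2_al2 : act w2 al2 = -al2 := by decide +kernel

@[simp] lemma act_w2_al3 : act w2 al3 = al3 + al2 := by decide +kernel

@[simp] lemma act_w3_al0 : act w3 al0 = al0 + al3 := by decide +kernel

@[simp] lemma act_w3_al1 : act w3 al1 = al1 := by decide +kernel

@[simp] lemma act_w3_al2 : act w3 al2 = al2 + al3 := by decide +kernel

@[simp] lemma act_w3_al3 : act w3 al3 = -al3 := by decide +kernel

@[simp] lemma act_sg1_al0 : act sg1 al0 = al3 := by decide +kernel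

@[simp] lemma act_sg1_al1 : act sg1 al1 = al2 := by decide +kernel

@[simp] lemma act_sg1_al2 : act sg1 al2 = al1 := by decide +kernel

@[simp] lemma act_sg1_al3 : act sg1 al3 = al0 := by decide +kernel

@[simp] lemma act_sg2_al0 : act sg2 al0 = al2 := by decide +kernel

@[simp] lemma act_sg2_al1 : act sg2 al1 = al1 := by decide +kernel

@[simp] lemma act_sg2_al2 : act sg2 al2 = al0 := by decide +kernel

@[simp] lemma act_sg2_al3 : act sg2 al3 = al3 := by decide +kernel

@[simp] lemma act_w0_dl : act w0 dl = dl := by decide +kernel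

@[simp] lemma act_w1_dl : act w1 dl = dl := by decide +kernel

@[simp] lemma act_w2_dl : act w2 dl = dl := by decide +kernel

@[simp] lemma act_w3_dl : act w3 dl = dl := by decide +kernel

@[simp] lemma act_sg1_dl : act sg1 dl = dl := by decide +kernel

@[simp] lemma act_sg2_dl : act sg2 dl = dl := by decide +kernel

/-! ### Reflection in `α₀ + α₁` and the two subgroups it organizes -/

/-- The reflection in `α₀ + α₁`. -/
def reflSum : PicAut := w0 * w1 * w0

/-- Generators of the pointwise stabilizer of `α₀ + α₁` and `α₂ + α₃`. -/
def fixGens : Set PicAut :=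
  {w0 * w3 * w0, w1 * w2 * w1, (sg1 * sg2) ^ 2 * sg1, sg2 * w2 * w0,
    sg1 * sg2 * sg1 * w3 * w1}

/-- The generators in the statement of `stmt0`. -/
def stabGens : Set PicAut :=
  {w0 * w3 * w0, w1 * w2 * w1, (sg1 * sg2) ^ 2, sg2 * w2 * w0,
    sg1 * sg2 * sg1 * w3 * w1, sg1}

lemma closure_fixGens_le : Subgroup.closure fixGens ≤ Subgroup.closure stabGens := by
  have hmem : ∀ x ∈ stabGens, x ∈ Subgroup.closure stabGens := fun x hx =>
    Subgroup.subset_closure hx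
  rw [Subgroup.closure_le]
  rintro x (rfl | rfl | rfl | rfl | rfl)
  · exact hmem _ (by simp [stabGens])
  · exact hmem _ (by simp [stabGens])
  · exact mul_mem (hmem _ (by simp only [stabGens, Set.mem_insert_iff, true_or, or_true]))
      (hmem _ (by simp only [stabGens, Set.mem_insert_iff, Set.mem_singleton_iff, or_true]))
  · exact hmem _ (by simp only [stabGens, Set.mem_insert_iff, true_or, or_true])
  · exact hmem _ (by simp only [stabGens, Set.mem_insert_iff, true_or, or_true])

lemma sg1_mem_closure_stabGens : sg1 ∈ Subgroup.closure stabGens :=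
  Subgroup.subset_closure (by
    simp only [stabGens, Set.mem_insert_iff, Set.mem_singleton_iff, or_true])

lemma mem_normalizer_closure_of_involution {G : Type*} [Group G] {S : Set G} {x : G}
    (hx : x * x = 1) (h : ∀ g ∈ S, x * g * x ∈ Subgroup.closure S) :
    x ∈ Subgroup.normalizer (Subgroup.closure S : Set G) := by
  have hinv : x⁻¹ = x := inv_eq_of_mul_eq_one_left hx
  have hle : ∀ g ∈ Subgroup.closure S, x * g * x⁻¹ ∈ Subgroup.closure S := by
    intro g hg
    have : Subgroup.closure S ≤ (Subgroup.closure S).comap (MulAut.conj x).toMonoidHom := by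
      rw [Subgroup.closure_le]
      intro g hg
      simpa [hinv] using h g hg
    simpa using this hg
  rw [Subgroup.mem_normalizer_iff]
  refine fun g => ⟨hle g, fun hg => ?_⟩
  have h2 := hle _ hg
  rw [hinv] at h2
  have : x * (x * g * x) * x = g := by
    rw [show x * (x * g * x) * x = (x * x) * g * (x * x) by simp only [mul_assoc], hx]; simp
  rwa [this] at h2

/-- The dihedral group generated by the reflection in `α₀ + α₁` and `σ₁`. -/
def dihedral : Subgroup PicAut := Subgroup.closure {reflSum, sg1}

lemma dihedral_le_normalizer :
    dihedral ≤ Subgroup.normalizer (Subgroup.closure fixGens : Set PicAut) := by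
  rw [dihedral, Subgroup.closure_le]
  have hmem : ∀ x y, y ∈ fixGens → x = y → x ∈ Subgroup.closure fixGens := by
    rintro x y hy rfl
    exact Subgroup.subset_closure hy
  rintro x (rfl | rfl)
  · refine mem_normalizer_closure_of_involution (by simp [reflSum, mul_assoc]) fun g hg =>
      hmem _ g hg ?_
    rcases hg with rfl | rfl | rfl | rfl | rfl <;> simp [reflSum, mul_assoc, pow_two]
  · refine mem_normalizer_closure_of_involution (by simp) ?_
    rintro x (rfl | rfl | rfl | rfl | rfl)
    · exact hmem _ (w0 * w3 * w0) (by simp [fixGens]) (by simp [mul_assoc])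
    · exact hmem _ (w1 * w2 * w1) (by simp [fixGens]) (by simp [mul_assoc])
    · exact hmem _ ((sg1 * sg2) ^ 2 * sg1)
        (by simp only [fixGens, Set.mem_insert_iff, true_or, or_true])
        (by simp [mul_assoc, pow_two])
    · exact hmem _ (sg1 * sg2 * sg1 * w3 * w1)
        (by simp only [fixGens, Set.mem_insert_iff, Set.mem_singleton_iff, or_true])
        (by simp [mul_assoc])
    · exact hmem _ (sg2 * w2 * w0)
        (by simp only [fixGens, Set.mem_insert_iff, true_or, or_true])
        (by simp [mul_assoc])

lemma exists_zpow_of_mem_dihedral {d : PicAut} (hd : d ∈ dihedral) :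
    ∃ k : ℤ, ∃ e ∈ ({1, sg1} : Set PicAut), d = (reflSum * sg1) ^ k * e := by
  have hr : reflSum⁻¹ = reflSum := by simp [reflSum, mul_assoc]
  have hrr : reflSum * reflSum = 1 := mul_eq_one_iff_inv_eq.2 hr
  have hconj : ∀ k : ℤ, sg1 * (reflSum * sg1) ^ k = (reflSum * sg1) ^ (-k) * sg1 := by
    intro k
    have h := conj_zpow (i := k) (a := sg1) (b := reflSum * sg1)
    have h2 : sg1 * (reflSum * sg1) * sg1⁻¹ = (reflSum * sg1)⁻¹ := by
      rw [mul_inv_rev, hr, sg1_inv, mul_assoc, mul_assoc, sg1_mul_self, mul_one]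
    rw [h2, inv_zpow', eq_mul_inv_iff_mul_eq] at h
    exact h.symm
  have hstep1 : ∀ x : PicAut,
      (∃ k : ℤ, ∃ e ∈ ({1, sg1} : Set PicAut), x = (reflSum * sg1) ^ k * e) →
      ∃ k : ℤ, ∃ e ∈ ({1, sg1} : Set PicAut), sg1 * x = (reflSum * sg1) ^ k * e := by
    rintro x ⟨k, e, he, rfl⟩
    refine ⟨-k, sg1 * e, ?_, by rw [← mul_assoc, hconj, mul_assoc]⟩
    rcases he with rfl | rfl <;> simp
  have hstep2 : ∀ x : PicAut,
      (∃ k : ℤ, ∃ e ∈ ({1, sg1} : Set PicAut), x = (reflSum * sg1) ^ k * e) →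
      ∃ k : ℤ, ∃ e ∈ ({1, sg1} : Set PicAut), reflSum * x = (reflSum * sg1) ^ k * e := by
    intro x hx
    obtain ⟨k, e, he, h⟩ := hstep1 x hx
    refine ⟨1 + k, e, he, ?_⟩
    rw [zpow_add, zpow_one, mul_assoc, ← h, mul_assoc, sg1_mul_self_assoc]
  induction hd using Subgroup.closure_induction_left with
  | one => exact ⟨0, 1, by simp, by simp⟩
  | mul_left x hx y _ hy =>
    rcases hx with rfl | rfl
    exacts [hstep2 y hy, hstep1 y hy]
  | inv_mul_cancel x hx y _ hy =>
    rcases hx with rfl | rfl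
    · rw [hr]; exact hstep2 y hy
    · rw [sg1_inv]; exact hstep1 y hy

/-- The stabilizer of `α₀ + α₁` modulo sign and `δ`. -/
def stabModDelta : Subgroup PicAut := dihedral ⊔ Subgroup.closure fixGens

lemma exists_zpow_of_mem_stabModDelta {x : PicAut} (hx : x ∈ stabModDelta) :
    ∃ k : ℤ, ∃ h ∈ Subgroup.closure stabGens, x = (reflSum * sg1) ^ k * h := by
  have hx' : x ∈ (dihedral : Set PicAut) * (Subgroup.closure fixGens : Set PicAut) := by
    rw [← Subgroup.coe_mul_of_left_le_normalizer_right _ _ dihedral_le_normalizer]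
    exact hx
  obtain ⟨d, hd, f, hf, rfl⟩ := hx'
  obtain ⟨k, e, he, rfl⟩ := exists_zpow_of_mem_dihedral hd
  refine ⟨k, e * f, mul_mem ?_ (closure_fixGens_le hf), mul_assoc _ _ _⟩
  rcases he with rfl | rfl
  exacts [one_mem _, sg1_mem_closure_stabGens]

/-- Coset representatives of `stabModDelta` in `Wh`. -/
def cosetReps : Set PicAut := {1, w0, w1, w2, w3, sg2}

lemma exists_cosetReps_of_mem_Wh {g : PicAut} (hg : g ∈ Wh) :
    ∃ u ∈ cosetReps, ∃ m ∈ stabModDelta, g = u * m := by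
  have hD : ∀ x ∈ ({reflSum, sg1} : Set PicAut), x ∈ stabModDelta := fun x hx =>
    (le_sup_left : dihedral ≤ stabModDelta) (Subgroup.subset_closure hx)
  have hF : ∀ x ∈ fixGens, x ∈ stabModDelta := fun x hx =>
    (le_sup_right : Subgroup.closure fixGens ≤ stabModDelta) (Subgroup.subset_closure hx)
  have ha : sg1 ∈ stabModDelta := hD _ (by simp)
  have hs : reflSum ∈ stabModDelta := hD _ (by simp)
  have hb0 : w0 * w3 * w0 ∈ stabModDelta := hF _ (by simp [fixGens])
  have hb1 : w1 * w2 * w1 ∈ stabModDelta := hF _ (by simp [fixGens])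
  have hp : (sg1 * sg2) ^ 2 * sg1 ∈ stabModDelta :=
    hF _ (by simp only [fixGens, Set.mem_insert_iff, true_or, or_true])
  have hc0 : sg2 * w2 * w0 ∈ stabModDelta :=
    hF _ (by simp only [fixGens, Set.mem_insert_iff, true_or, or_true])
  have hc1 : sg1 * sg2 * sg1 * w3 * w1 ∈ stabModDelta :=
    hF _ (by simp only [fixGens, Set.mem_insert_iff, Set.mem_singleton_iff, or_true])
  have hc0' := inv_mem hc0
  have hp' : (sg1 * sg2) ^ 2 ∈ stabModDelta := by
    have := mul_mem hp ha
    rwa [mul_assoc, sg1_mul_self, mul_one] at this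
  have ht : sg2 * w1 * w3 ∈ stabModDelta := by
    have := mul_mem hp' hc1
    have e : (sg1 * sg2) ^ 2 * (sg1 * sg2 * sg1 * w3 * w1) = sg2 * w1 * w3 := by
      simp [mul_assoc, pow_two]
    rwa [e] at this
  have ht' := inv_mem ht
  have has := mul_mem (mul_mem ha hs) ha
  have hap := mul_mem ha hp'
  have key : ∀ s ∈ ({w0, w1, w2, w3, sg1, sg2} : Set PicAut), ∀ u ∈ cosetReps,
      ∃ v ∈ cosetReps, ∃ m ∈ stabModDelta, s * u = v * m := by
    have h0 : (1 : PicAut) ∈ cosetReps := by simp [cosetReps]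
    have hw0 : w0 ∈ cosetReps := by simp [cosetReps]
    have hw1 : w1 ∈ cosetReps := by simp [cosetReps]
    have hw2 : w2 ∈ cosetReps := by simp [cosetReps]
    have hw3 : w3 ∈ cosetReps := by simp [cosetReps]
    have hsg2 : sg2 ∈ cosetReps := by simp [cosetReps]
    have h1 : (1 : PicAut) ∈ stabModDelta := one_mem _
    rintro s (rfl | rfl | rfl | rfl | rfl | rfl) u (rfl | rfl | rfl | rfl | rfl | rfl)
    · exact ⟨_, hw0, _, h1, by simp⟩
    · exact ⟨_, h0, _, h1, by simp⟩
    · exact ⟨_, hw1, _, hs, by simp [reflSum, mul_assoc]⟩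
    · exact ⟨_, hsg2, _, hc0, by simp [mul_assoc]⟩
    · exact ⟨_, hw3, _, hb0, by simp [mul_assoc]⟩
    · exact ⟨_, hw2, _, hc0', by simp [mul_assoc]⟩
    · exact ⟨_, hw1, _, h1, by simp⟩
    · exact ⟨_, hw0, _, hs, by simp [reflSum, mul_assoc]⟩
    · exact ⟨_, h0, _, h1, by simp⟩
    · exact ⟨_, hw2, _, hb1, by simp [mul_assoc]⟩
    · exact ⟨_, hsg2, _, ht, by simp [mul_assoc]⟩
    · exact ⟨_, hw3, _, ht', by simp [mul_assoc]⟩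
    · exact ⟨_, hw2, _, h1, by simp⟩
    · exact ⟨_, hsg2, _, hc0, by simp [mul_assoc]⟩
    · exact ⟨_, hw1, _, hb1, by simp [mul_assoc]⟩
    · exact ⟨_, h0, _, h1, by simp⟩
    · exact ⟨_, hw3, _, has, by simp [reflSum, mul_assoc]⟩
    · exact ⟨_, hw0, _, hc0', by simp [mul_assoc]⟩
    · exact ⟨_, hw3, _, h1, by simp⟩
    · exact ⟨_, hw0, _, hb0, by simp [mul_assoc]⟩
    · exact ⟨_, hsg2, _, ht, by simp [mul_assoc]⟩
    · exact ⟨_, hw2, _, has, by simp [reflSum, mul_assoc]⟩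
    · exact ⟨_, h0, _, h1, by simp⟩
    · exact ⟨_, hw1, _, ht', by simp [mul_assoc]⟩
    · exact ⟨_, h0, _, ha, by simp⟩
    · exact ⟨_, hw3, _, ha, by simp⟩
    · exact ⟨_, hw2, _, ha, by simp⟩
    · exact ⟨_, hw1, _, ha, by simp⟩
    · exact ⟨_, hw0, _, ha, by simp⟩
    · exact ⟨_, hsg2, _, hap, by simp [mul_assoc, pow_two]⟩
    · exact ⟨_, hsg2, _, h1, by simp⟩
    · exact ⟨_, hw0, _, hc0', by simp [mul_assoc]⟩
    · exact ⟨_, hw3, _, ht', by simp [mul_assoc]⟩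
    · exact ⟨_, hw2, _, hc0', by simp [mul_assoc]⟩
    · exact ⟨_, hw1, _, ht, by simp [mul_assoc]⟩
    · exact ⟨_, h0, _, h1, by simp⟩
  have step : ∀ s ∈ ({w0, w1, w2, w3, sg1, sg2} : Set PicAut), ∀ y : PicAut,
      (∃ u ∈ cosetReps, ∃ m ∈ stabModDelta, y = u * m) →
      ∃ u ∈ cosetReps, ∃ m ∈ stabModDelta, s * y = u * m := by
    rintro s hs y ⟨u, hu, m, hm, rfl⟩
    obtain ⟨v, hv, n, hn, h⟩ := key s hs u hu
    exact ⟨v, hv, n * m, mul_mem hn hm, by rw [← mul_assoc, h, mul_assoc]⟩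
  induction hg using Subgroup.closure_induction_left with
  | one => exact ⟨1, by simp [cosetReps], 1, one_mem _, by simp⟩
  | mul_left x hx y _ hy => exact step x hx y hy
  | inv_mul_cancel x hx y _ hy =>
    have hinv : x⁻¹ = x := by rcases hx with rfl | rfl | rfl | rfl | rfl | rfl <;> simp
    rw [hinv]
    exact step x hx y hy

lemma act_reflSum_mul_sg1_zpow (k : ℤ) :
    act ((reflSum * sg1) ^ k) (al0 + al1) = al0 + al1 + k • dl := by
  have hc : act (reflSum * sg1) (al0 + al1) = al0 + al1 + dl := by decide +kernel
  have hd : act (reflSum * sg1) dl = dl := by simp [reflSum, act_mul]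
  have hd' : act (reflSum * sg1)⁻¹ dl = dl := by
    simpa only [hd] using act_inv_act (reflSum * sg1) dl
  have hc' : act (reflSum * sg1)⁻¹ (al0 + al1) = al0 + al1 + -dl := by
    have h := act_inv_act (reflSum * sg1) (al0 + al1)
    rw [hc, act_add, hd'] at h
    exact eq_add_neg_of_add_eq h
  induction k using Int.induction_on with
  | zero => simp
  | succ i ih =>
    rw [add_comm, zpow_add, zpow_one, act_mul, ih, act_add, act_zsmul, hc, hd, add_smul, one_smul,
      add_assoc]
  | pred i ih =>
    rw [sub_eq_neg_add, zpow_add, zpow_neg_one, act_mul, ih, act_add, act_zsmul, hc', hd',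
      add_smul, neg_one_smul, add_assoc]

lemma act_mul_image (g h : PicAut) (S : Set Pic) :
    act (g * h) '' S = act g '' (act h '' S) := by
  rw [Set.image_image]
  simp only [act_mul]

lemma act_image_Spair_of_mem_stabGens {x : PicAut} (hx : x ∈ stabGens) :
    act x '' Spair = Spair := by
  have fix : ∀ g : PicAut, act g (al0 + al1) = al0 + al1 → act g (al2 + al3) = al2 + al3 →
      act g '' Spair = Spair := by
    intro g h1 h2
    rw [Spair, Set.image_pair, h1, h2]
  have swap : ∀ g : PicAut, act g (al0 + al1) = al2 + al3 → act g (al2 + al3) = al0 + al1 →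
      act g '' Spair = Spair := by
    intro g h1 h2
    rw [Spair, Set.image_pair, h1, h2, Set.pair_comm]
  rcases hx with rfl | rfl | rfl | rfl | rfl | rfl
  · apply fix <;> simp [act_mul] <;> abel
  · apply fix <;> simp [act_mul] <;> abel
  · apply swap <;> simp [act_mul, pow_two]
  · apply fix <;> simp [act_mul] <;> abel
  · apply fix <;> simp [act_mul] <;> abel
  · apply swap <;> simp <;> abel

lemma stabGens_subset_Wh : stabGens ⊆ Wh := by
  have hmem : ∀ x ∈ ({w0, w1, w2, w3, sg1, sg2} : Set PicAut), x ∈ Wh := fun x hx =>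
    Subgroup.subset_closure hx
  have h0 : w0 ∈ Wh := hmem _ (by simp)
  have h1 : w1 ∈ Wh := hmem _ (by simp)
  have h2 : w2 ∈ Wh := hmem _ (by simp)
  have h3 : w3 ∈ Wh := hmem _ (by simp)
  have h4 : sg1 ∈ Wh := hmem _ (by simp)
  have h5 : sg2 ∈ Wh := hmem _ (by simp)
  rintro x (rfl | rfl | rfl | rfl | rfl | rfl)
  · exact mul_mem (mul_mem h0 h3) h0
  · exact mul_mem (mul_mem h1 h2) h1
  · exact pow_mem (mul_mem h4 h5) 2
  · exact mul_mem (mul_mem h5 h2) h0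
  · exact mul_mem (mul_mem (mul_mem (mul_mem h4 h5) h4) h3) h1
  · exact h4

lemma act_image_Spair_of_mem_closure {x : PicAut} (hx : x ∈ Subgroup.closure stabGens) :
    act x '' Spair = Spair := by
  induction hx using Subgroup.closure_induction with
  | mem x hx => exact act_image_Spair_of_mem_stabGens hx
  | one => simp
  | mul x y _ _ hx hy => rw [act_mul_image, hy, hx]
  | inv x _ hx =>
    nth_rewrite 1 [← hx]
    rw [Set.image_image]
    simp

lemma eq_one_and_eq_zero_of_act_mem_Spair {u : PicAut} (hu : u ∈ cosetReps) {k : ℤ}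
    (h : act u (al0 + al1 + k • dl) ∈ Spair) : u = 1 ∧ k = 0 := by
  have coords : ∀ {x y : Pic}, x = y → x 0 = y 0 ∧ x 1 = y 1 ∧ x 2 = y 2 ∧ x 4 = y 4 ∧
      x 6 = y 6 ∧ x 8 = y 8 := by
    rintro x _ rfl
    simp
  rcases hu with rfl | rfl | rfl | rfl | rfl | rfl <;>
    simp only [act_one, act_add, act_zsmul, act_w0_al0, act_w0_al1, act_w0_dl, act_w1_al0,
      act_w1_al1, act_w1_dl, act_w2_al0, act_w2_al1, act_w2_dl, act_w3_al0, act_w3_al1,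
      act_w3_dl, act_sg2_al0, act_sg2_al1, act_sg2_dl] at h <;>
    rcases h with h | h <;>
    have h' := coords h <;>
    simp [al0, al1, al2, al3, dl] at h' <;>
    first
      | exact ⟨rfl, by omega⟩
      | omega

/-- The setwise stabilizer `G` of `{α₀+α₁, α₂+α₃}` in `Ŵ` is generated by
`r_{β₀} = w₀w₃w₀`, `r_{β₁} = w₁w₂w₁`, `π_β = (σ₁σ₂)²`,
`r_{γ₀} = σ₂w₂w₀`, `r_{γ₁} = σ₁σ₂σ₁w₃w₁`, and `π_γ = σ₁`. -/
theorem stmt0 :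
    ∀ g : PicAut, (g ∈ Wh ∧ act g '' Spair = Spair) ↔
      g ∈ Subgroup.closure {w0 * w3 * w0, w1 * w2 * w1, (sg1 * sg2) ^ 2,
        sg2 * w2 * w0, sg1 * sg2 * sg1 * w3 * w1, sg1} := by
  intro g
  change (g ∈ Wh ∧ act g '' Spair = Spair) ↔ g ∈ Subgroup.closure stabGens
  constructor
  · rintro ⟨hg, hS⟩
    obtain ⟨u, hu, m, hm, rfl⟩ := exists_cosetReps_of_mem_Wh hg
    obtain ⟨k, h, hh, rfl⟩ := exists_zpow_of_mem_stabModDelta hm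
    rw [act_mul_image, act_mul_image, act_image_Spair_of_mem_closure hh] at hS
    have hB : act u (al0 + al1 + k • dl) ∈ Spair := by
      rw [← act_reflSum_mul_sg1_zpow, ← hS]
      exact Set.mem_image_of_mem _ (Set.mem_image_of_mem _ (Set.mem_insert _ _))
    obtain ⟨rfl, rfl⟩ := eq_one_and_eq_zero_of_act_mem_Spair hu hB
    simpa using hh
  · exact fun hg => ⟨(Subgroup.closure_le _).2 stabGens_subset_Wh hg,
      act_image_Spair_of_mem_closure hg⟩
end

section
/- In Ŵ the square of the quasi-translation φ_* = σ1∘σ2∘w2∘w0 equals the translation ψ_* = σ1∘σ2∘σ1∘σ2∘w3∘w1∘w2∘w0; that is, (σ1∘σ2∘w2∘w0)∘(σ1∘σ2∘w2∘w0) = σ1∘σ2∘σ1∘σ2∘w3∘w1∘w2∘w0 as automorphisms of Pic. -/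
open Pointwise

lemma w0_mul_sg1 : w0 * sg1 = sg1 * w3 := Units.ext (by decide)

lemma w2_mul_sg1 : w2 * sg1 = sg1 * w1 := Units.ext (by decide)

lemma w1_mul_sg2 : w1 * sg2 = sg2 * w1 := Units.ext (by decide)

lemma w3_mul_sg2 : w3 * sg2 = sg2 * w3 := Units.ext (by decide)

lemma w1_mul_w3 : w1 * w3 = w3 * w1 := Units.ext (by decide)

/-- In `Ŵ` the square of the quasi-translation `φ⁎ = σ₁σ₂w₂w₀` is the translation
`ψ⁎ = σ₁σ₂σ₁σ₂w₃w₁w₂w₀`. -/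
theorem stmt3 :
    (sg1 * sg2 * w2 * w0) * (sg1 * sg2 * w2 * w0) =
      sg1 * sg2 * sg1 * sg2 * w3 * w1 * w2 * w0 := by
  calc (sg1 * sg2 * w2 * w0) * (sg1 * sg2 * w2 * w0)
      = sg1 * sg2 * w2 * (w0 * sg1) * sg2 * w2 * w0 := by group
    _ = sg1 * sg2 * (w2 * sg1) * (w3 * sg2) * w2 * w0 := by rw [w0_mul_sg1]; group
    _ = sg1 * sg2 * sg1 * (w1 * sg2) * w3 * w2 * w0 := by rw [w2_mul_sg1, w3_mul_sg2]; group
    _ = sg1 * sg2 * sg1 * sg2 * (w1 * w3) * w2 * w0 := by rw [w1_mul_sg2]; group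
    _ = sg1 * sg2 * sg1 * sg2 * w3 * w1 * w2 * w0 := by rw [w1_mul_w3]; group
end

section
/- The element φ_* = σ1∘σ2∘w2∘w0 of Ŵ maps the symmetry roots as φ_*(α0) = −α1, φ_*(α1) = δ − α0, φ_*(α2) = −α3, φ_*(α3) = δ − α2. Consequently φ_* is not a translation on the symmetry root span: there is no h ∈ Pic⊗ℚ such that φ_*(v) = v − (h•v)δ for all v in the ℚ-span of α0, α1, α2, α3. -/
open Pointwise

/-- `Pic ⊗ ℚ`. -/
abbrev PicQ : Type := Fin 10 → ℚ

/-- The intersection form on `Pic ⊗ ℚ`. -/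
def interQ (x y : PicQ) : ℚ :=
  x 0 * y 1 + x 1 * y 0 -
    (x 2 * y 2 + x 3 * y 3 + x 4 * y 4 + x 5 * y 5 + x 6 * y 6 +
      x 7 * y 7 + x 8 * y 8 + x 9 * y 9)

/-- The natural map `Pic → Pic ⊗ ℚ`. -/
def toQ (v : Pic) : PicQ := fun i => (v i : ℚ)

/-- The action of an automorphism of `Pic` on `Pic ⊗ ℚ`. -/
def actQ (g : PicAut) (v : PicQ) : PicQ := (g.val.map (Int.cast : ℤ → ℚ)).mulVec v

/-- The fundamental weight `h₁ = (3α₁ + 2α₂ + α₃)/4` of the finite `A₃` subsystem. -/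
def h1Q : PicQ := (3/4 : ℚ) • toQ al1 + (1/2 : ℚ) • toQ al2 + (1/4 : ℚ) • toQ al3
/-- The fundamental weight `h₂ = (α₁ + 2α₂ + α₃)/2` of the finite `A₃` subsystem. -/
def h2Q : PicQ := (1/2 : ℚ) • toQ al1 + (1 : ℚ) • toQ al2 + (1/2 : ℚ) • toQ al3
/-- The fundamental weight `h₃ = (α₁ + 2α₂ + 3α₃)/4` of the finite `A₃` subsystem. -/
def h3Q : PicQ := (1/4 : ℚ) • toQ al1 + (1/2 : ℚ) • toQ al2 + (3/4 : ℚ) • toQ al3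

/-- The ℚ-span of the symmetry roots `α₀, α₁, α₂, α₃`. -/
def symmSpan : Submodule ℚ PicQ :=
  Submodule.span ℚ ({toQ al0, toQ al1, toQ al2, toQ al3} : Set PicQ)

/-- `φ⁎ = σ₁σ₂w₂w₀`. -/
def phi : PicAut := sg1 * sg2 * w2 * w0

lemma actQ_toQ (g : PicAut) (v : Pic) : actQ g (toQ v) = toQ (act g v) := by
  ext i
  simp [actQ, toQ, act, Matrix.mulVec, dotProduct]

lemma act_phi (v : Pic) : act phi v = act sg1 (act sg2 (act w2 (act w0 v))) := by
  simp [phi, act, Matrix.mulVec_mulVec, Matrix.mul_assoc]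

lemma act_phi_al0 : act phi al0 = -al1 := by
  have e0 : act w0 al0 = -al0 := by decide
  have e1 : act w2 (-al0) = -al0 := by decide
  have e2 : act sg2 (-al0) = -al2 := by decide
  have e3 : act sg1 (-al2) = -al1 := by decide
  rw [act_phi, e0, e1, e2, e3]

lemma act_phi_al1 : act phi al1 = dl - al0 := by
  have e0 : act w0 al1 = al0 + al1 := by decide
  have e1 : act w2 (al0 + al1) = al0 + al1 + al2 := by decide
  have e2 : act sg2 (al0 + al1 + al2) = al0 + al1 + al2 := by decide
  have e3 : act sg1 (al0 + al1 + al2) = dl - al0 := by decide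
  rw [act_phi, e0, e1, e2, e3]

lemma act_phi_al2 : act phi al2 = -al3 := by
  have e0 : act w0 al2 = al2 := by decide
  have e1 : act w2 al2 = -al2 := by decide
  have e2 : act sg2 (-al2) = -al0 := by decide
  have e3 : act sg1 (-al0) = -al3 := by decide
  rw [act_phi, e0, e1, e2, e3]

lemma act_phi_al3 : act phi al3 = dl - al2 := by
  have e0 : act w0 al3 = al0 + al3 := by decide
  have e1 : act w2 (al0 + al3) = al0 + al2 + al3 := by decide
  have e2 : act sg2 (al0 + al2 + al3) = al0 + al2 + al3 := by decide
  have e3 : act sg1 (al0 + al2 + al3) = dl - al2 := by decide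
  rw [act_phi, e0, e1, e2, e3]

/-- `φ⁎` maps `α₀ ↦ -α₁`, `α₁ ↦ δ - α₀`, `α₂ ↦ -α₃`, `α₃ ↦ δ - α₂`; consequently
`φ⁎` is not a translation on the ℚ-span of the symmetry roots: there is no
`h ∈ Pic ⊗ ℚ` with `φ⁎(v) = v - (h•v)δ` for all `v` in that span. -/
theorem stmt5 :
    act phi al0 = -al1 ∧ act phi al1 = dl - al0 ∧
    act phi al2 = -al3 ∧ act phi al3 = dl - al2 ∧
    ¬ ∃ h : PicQ, ∀ v ∈ symmSpan, actQ phi v = v - interQ h v • toQ dl := by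
  refine ⟨act_phi_al0, act_phi_al1, act_phi_al2, act_phi_al3, ?_⟩
  rintro ⟨h, hh⟩
  have key := hh (toQ al0) (Submodule.subset_span (by simp))
  rw [actQ_toQ, act_phi_al0] at key
  have k1 := congrFun key 1
  have k2 := congrFun key 2
  simp only [Pi.sub_apply, Pi.smul_apply, smul_eq_mul] at k1 k2
  generalize interQ h (toQ al0) = c at k1 k2
  simp [toQ, al0, al1, dl] at k1 k2
  linarith
end

section
/- The automorphisms s0 = w0, s1 = w2, s2 = w3, s3 = σ3 of Pic satisfy the Coxeter relations of affine type B3^(1): s_i∘s_i = id for all i ∈ {0,1,2,3}, (s0∘s1)² = (s0∘s3)² = (s1∘s3)² = id, (s0∘s2)³ = (s1∘s2)³ = id, and (s2∘s3)⁴ = id. Moreover σ2∘σ2 = id and σ2∘s0 = s1∘σ2 (so that σ2 realizes the nontrivial automorphism of the B3^(1) Dynkin diagram). -/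
open Pointwise

theorem mkAut_mul_self (M : Matrix (Fin 10) (Fin 10) ℤ) (h : M * M = 1) :
    mkAut M h * mkAut M h = 1 := Units.ext h

theorem mul_sq_eq_one_of_commute {G : Type*} [Group G] {a b : G} (ha : a * a = 1)
    (hb : b * b = 1) (h : a * b = b * a) : (a * b) ^ 2 = 1 := by
  rw [Commute.mul_pow h, pow_two, pow_two, ha, hb, mul_one]

/-- If the product of two involutions `a`, `b` equals both `r * a` and `b * r` for a third
involution `r`, then it has order dividing `3`. -/
theorem mul_pow_three_eq_one {G : Type*} [Group G] {a b r : G} (ha : a * a = 1)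
    (hb : b * b = 1) (hr : r * r = 1) (h₁ : a * b = r * a) (h₂ : a * b = b * r) :
    (a * b) ^ 3 = 1 := by
  calc (a * b) ^ 3 = (a * b) * (a * b) * (a * b) := by rw [pow_three']
    _ = (r * a) * (a * b) * (b * r) := by rw [← h₁, ← h₂]
    _ = r * (a * a) * (b * b) * r := by simp only [mul_assoc]
    _ = 1 := by rw [ha, hb, mul_one, mul_one, hr]

/-- If an involution `s` conjugates `a` to a commuting involution `b`, then `a * s` has order
dividing `4`. -/
theorem mul_pow_four_eq_one {G : Type*} [Group G] {a b s : G} (ha : a * a = 1)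
    (hb : b * b = 1) (hs : s * s = 1) (h : s * a = b * s) (hab : a * b = b * a) :
    (a * s) ^ 4 = 1 := by
  have hsq : (a * s) ^ 2 = a * b := by
    calc (a * s) ^ 2 = a * (s * a) * s := by rw [pow_two]; simp only [mul_assoc]
      _ = a * b * (s * s) := by rw [h]; simp only [mul_assoc]
      _ = a * b := by rw [hs, mul_one]
  rw [show 4 = 2 * 2 from rfl, pow_mul, hsq, mul_sq_eq_one_of_commute ha hb hab]

/-- The reflection in `α₀ + α₃`. -/
def reflAl03 : PicAut := mkAut (reflMat (al0 + al3)) (by decide)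

/-- The reflection in `α₂ + α₃`. -/
def reflAl23 : PicAut := mkAut (reflMat (al2 + al3)) (by decide)

/-- `s₀ = w₀, s₁ = w₂, s₂ = w₃, s₃ = σ₃` satisfy the Coxeter relations of affine
type `B₃⁽¹⁾`, and `σ₂` realizes the nontrivial automorphism of the `B₃⁽¹⁾`
Dynkin diagram: `σ₂² = 1` and `σ₂ s₀ = s₁ σ₂`. -/
theorem stmt8 :
    w0 * w0 = 1 ∧ w2 * w2 = 1 ∧ w3 * w3 = 1 ∧ sg3 * sg3 = 1 ∧
    (w0 * w2) ^ 2 = 1 ∧ (w0 * sg3) ^ 2 = 1 ∧ (w2 * sg3) ^ 2 = 1 ∧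
    (w0 * w3) ^ 3 = 1 ∧ (w2 * w3) ^ 3 = 1 ∧
    (w3 * sg3) ^ 4 = 1 ∧
    sg2 * sg2 = 1 ∧ sg2 * w0 = w2 * sg2 := by
  have h_w0 : w0 * w0 = 1 := mkAut_mul_self _ _
  have h_w1 : w1 * w1 = 1 := mkAut_mul_self _ _
  have h_w2 : w2 * w2 = 1 := mkAut_mul_self _ _
  have h_w3 : w3 * w3 = 1 := mkAut_mul_self _ _
  have h_sg2 : sg2 * sg2 = 1 := mkAut_mul_self _ _
  have h_sg3 : sg3 * sg3 = 1 := mkAut_mul_self _ _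
  have h_reflAl03 : reflAl03 * reflAl03 = 1 := mkAut_mul_self _ _
  have h_reflAl23 : reflAl23 * reflAl23 = 1 := mkAut_mul_self _ _
  exact ⟨h_w0, h_w2, h_w3, h_sg3,
    mul_sq_eq_one_of_commute h_w0 h_w2 (Units.ext (by decide)),
    mul_sq_eq_one_of_commute h_w0 h_sg3 (Units.ext (by decide)),
    mul_sq_eq_one_of_commute h_w2 h_sg3 (Units.ext (by decide)),
    mul_pow_three_eq_one h_w0 h_w3 h_reflAl03 (Units.ext (by decide)) (Units.ext (by decide)),
    mul_pow_three_eq_one h_w2 h_w3 h_reflAl23 (Units.ext (by decide)) (Units.ext (by decide)),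
    mul_pow_four_eq_one h_w3 h_w1 h_sg3 (Units.ext (by decide)) (Units.ext (by decide)),
    h_sg2, Units.ext (by decide)⟩
end
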